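/- arXiv:1210.3426 — 3 statements merged into one kernel-verified Lean document; each statement's English description precedes it below -/
import Mathlib

section
/- Let n = 2m, let J be the standard skew-symmetric matrix, and let K ∈ Mat_n(ℂ) be symmetric with iK of positive-definite real part. Define the star-delta function of full variables D(u) = (2πħ)^(−n/2) ∫_{ℝⁿ} exp( (1/(4iħ)) ξKξᵀ + (1/(iħ)) ⟨ξ, u⟩ ) dξ for u ∈ ℂⁿ. Then D anticommutes with every generator: for every i ∈ {1,…,n} and every u ∈ ℂⁿ, u_i *_K D + D *_K u_i = 0, where u_i *_K D = u_i D + (iħ/2) Σ_j Λ_{ij} ∂_j D and D *_K u_i = D u_i + (iħ/2) Σ_j Λ_{ji} ∂_j D with Λ = K + J; equivalently, 2 u_i D(u) + iħ Σ_j K_{ij} (∂_{u_j} D)(u) = 0. -/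
open MeasureTheory

noncomputable section

variable {ι : Type} [Fintype ι] [DecidableEq ι]

/-- The bilinear form `a M bᵀ = ∑ᵢⱼ aᵢ Mᵢⱼ bⱼ` (no conjugation). -/
def bil (M : Matrix ι ι ℂ) (a b : ι → ℂ) : ℂ :=
  ∑ i, ∑ j, a i * M i j * b j

/-- The pairing `⟨a,b⟩ = ∑ᵢ aᵢ bᵢ` (no conjugation). -/
def dotc (a b : ι → ℂ) : ℂ := ∑ i, a i * b i

/-- Inclusion of a real row vector into ℂⁿ. -/
def cvec (x : ι → ℝ) : ι → ℂ := fun i => (x i : ℂ)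

/-- The partial derivative `∂ᵢ` of a function on ℂⁿ. -/
def pd (i : ι) (f : (ι → ℂ) → ℂ) : (ι → ℂ) → ℂ :=
  fun u => fderiv ℂ f u (Pi.single i 1)

variable {κ : Type} [Fintype κ]

/-- The Gaussian integrand `exp(ξMξᵀ + b⟨ξ,u⟩)`. -/
def gaussKernel (M : Matrix ι ι ℂ) (b : ℂ) (u : ι → ℂ) (ξ : ι → ℝ) : ℂ :=
  Complex.exp (bil M (cvec ξ) (cvec ξ) + b * dotc (cvec ξ) u)

lemma continuous_gaussKernel (M : Matrix κ κ ℂ) (b : ℂ) (u : κ → ℂ) :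
    Continuous (gaussKernel M b u) := by
  unfold gaussKernel bil dotc cvec
  fun_prop

lemma exists_sum_sq_le_neg_re_bil (M : Matrix κ κ ℂ)
    (hM : ∀ ξ : κ → ℝ, ξ ≠ 0 → (bil M (cvec ξ) (cvec ξ)).re < 0) :
    ∃ c > 0, ∀ ξ : κ → ℝ, (bil M (cvec ξ) (cvec ξ)).re ≤ -(c * ∑ i, ξ i ^ 2) := by
  have hcont : Continuous fun ξ : κ → ℝ => (bil M (cvec ξ) (cvec ξ)).re := by
    unfold bil cvec
    fun_prop
  rcases isEmpty_or_nonempty κ with hκ | hκ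
  · exact ⟨1, one_pos, fun ξ => by simp [bil]⟩
  obtain ⟨x, hx, hmax⟩ := (isCompact_sphere (0 : κ → ℝ) 1).exists_isMaxOn
    (NormedSpace.sphere_nonempty.2 zero_le_one) hcont.continuousOn
  have hx0 : x ≠ 0 := by
    rintro rfl
    simp at hx
  set d := -(bil M (cvec x) (cvec x)).re with hd
  have hdpos : 0 < d := by have := hM x hx0; linarith
  have hn : (0 : ℝ) < Fintype.card κ := by exact_mod_cast Fintype.card_pos
  refine ⟨d / Fintype.card κ, by positivity, fun ξ => ?_⟩
  have hsum : ∑ i, ξ i ^ 2 ≤ Fintype.card κ * ‖ξ‖ ^ 2 := by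
    calc ∑ i, ξ i ^ 2 ≤ ∑ _i : κ, ‖ξ‖ ^ 2 := by
          refine Finset.sum_le_sum fun i _ => ?_
          rw [← sq_abs]
          exact pow_le_pow_left₀ (abs_nonneg _) (norm_le_pi_norm ξ i) 2
      _ = _ := by simp
  have hquad : (bil M (cvec ξ) (cvec ξ)).re ≤ -(d * ‖ξ‖ ^ 2) := by
    rcases eq_or_ne ξ 0 with rfl | hξ
    · simp [bil, cvec]
    have hnorm : 0 < ‖ξ‖ := norm_pos_iff.2 hξ
    have hmem : ‖ξ‖⁻¹ • ξ ∈ Metric.sphere (0 : κ → ℝ) 1 := by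
      simp [norm_smul, hnorm.ne']
    have hle := hmax hmem
    have hhom : bil M (cvec ξ) (cvec ξ) =
        ((‖ξ‖ ^ 2 : ℝ) : ℂ) * bil M (cvec (‖ξ‖⁻¹ • ξ)) (cvec (‖ξ‖⁻¹ • ξ)) := by
      have hne : (‖ξ‖ : ℂ) ≠ 0 := by exact_mod_cast hnorm.ne'
      simp only [bil, cvec, Finset.mul_sum, Pi.smul_apply, smul_eq_mul]
      refine Finset.sum_congr rfl fun i _ => Finset.sum_congr rfl fun j _ => ?_
      push_cast
      field_simp
    rw [hhom, Complex.re_ofReal_mul]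
    have : (bil M (cvec (‖ξ‖⁻¹ • ξ)) (cvec (‖ξ‖⁻¹ • ξ))).re ≤ -d := by
      simpa [hd] using hle
    nlinarith [sq_nonneg ‖ξ‖]
  have : d / Fintype.card κ * ∑ i, ξ i ^ 2 ≤ d * ‖ξ‖ ^ 2 := by
    rw [div_mul_eq_mul_div, div_le_iff₀ hn]
    nlinarith
  linarith

/-- Domination of the Gaussian integrand with linear weight, locally uniformly in `u`. -/
lemma exists_integrable_bound_gaussKernel (M : Matrix κ κ ℂ) (b : ℂ)
    (hM : ∀ ξ : κ → ℝ, ξ ≠ 0 → (bil M (cvec ξ) (cvec ξ)).re < 0) (R : ℝ) :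
    ∃ g : (κ → ℝ) → ℝ, Integrable g ∧ ∀ u : κ → ℂ, ‖u‖ ≤ R → ∀ ξ,
      (1 + ∑ i, |ξ i|) * ‖gaussKernel M b u ξ‖ ≤ g ξ := by
  obtain ⟨c, hc, hbound⟩ := exists_sum_sq_le_neg_re_bil M hM
  set r := ‖b‖ * R + 1 with hr
  refine ⟨fun ξ => ∏ i, Real.exp (r ^ 2 / (2 * c)) * Real.exp (-(c / 2) * ξ i ^ 2), ?_, ?_⟩
  · exact Integrable.fintype_prod (f := fun _ : κ => fun x : ℝ =>
      Real.exp (r ^ 2 / (2 * c)) * Real.exp (-(c / 2) * x ^ 2))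
      fun _ => (integrable_exp_neg_mul_sq (by positivity)).const_mul _
  intro u hu ξ
  have hlin : (b * dotc (cvec ξ) u).re ≤ ‖b‖ * R * ∑ i, |ξ i| := by
    refine (Complex.re_le_norm _).trans ?_
    rw [norm_mul, mul_assoc]
    refine mul_le_mul_of_nonneg_left ?_ (norm_nonneg b)
    rw [dotc, Finset.mul_sum]
    refine (norm_sum_le _ _).trans (Finset.sum_le_sum fun i _ => ?_)
    rw [norm_mul, mul_comm, cvec, Complex.norm_real, Real.norm_eq_abs]
    exact mul_le_mul_of_nonneg_right ((norm_le_pi_norm u i).trans hu) (abs_nonneg _)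
  have hweight : 1 + ∑ i, |ξ i| ≤ Real.exp (∑ i, |ξ i|) := by
    rw [add_comm]
    exact Real.add_one_le_exp _
  rw [gaussKernel, Complex.norm_exp, Complex.add_re]
  refine (mul_le_mul_of_nonneg_right hweight (Real.exp_pos _).le).trans ?_
  simp_rw [← Real.exp_add]
  rw [← Real.exp_sum, Real.exp_le_exp]
  calc ∑ i, |ξ i| + ((bil M (cvec ξ) (cvec ξ)).re + (b * dotc (cvec ξ) u).re)
      ≤ ∑ i, |ξ i| + (-(c * ∑ i, ξ i ^ 2) + ‖b‖ * R * ∑ i, |ξ i|) := by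
        gcongr
        exact hbound ξ
    _ = ∑ i, (r * |ξ i| - c * ξ i ^ 2) := by
        rw [Finset.sum_sub_distrib, ← Finset.mul_sum, ← Finset.mul_sum]
        ring
    _ ≤ _ := by
        refine Finset.sum_le_sum fun i _ => ?_
        have hsq : r ^ 2 / (2 * c) + -(c / 2) * ξ i ^ 2 - (r * |ξ i| - c * ξ i ^ 2) =
            (r - c * |ξ i|) ^ 2 / (2 * c) := by
          rw [← sq_abs (ξ i)]
          field_simp
          ring
        have : 0 ≤ (r - c * |ξ i|) ^ 2 / (2 * c) := by positivity
        linarith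

lemma integrable_gaussKernel (M : Matrix κ κ ℂ) (b : ℂ)
    (hM : ∀ ξ : κ → ℝ, ξ ≠ 0 → (bil M (cvec ξ) (cvec ξ)).re < 0) (u : κ → ℂ) :
    Integrable (gaussKernel M b u) := by
  obtain ⟨g, hg, hle⟩ := exists_integrable_bound_gaussKernel M b hM ‖u‖
  refine hg.mono' (continuous_gaussKernel M b u).aestronglyMeasurable (.of_forall fun ξ => ?_)
  refine le_trans ?_ (hle u le_rfl ξ)
  have : 0 ≤ ∑ i, |ξ i| := Finset.sum_nonneg fun i _ => abs_nonneg _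
  nlinarith [norm_nonneg (gaussKernel M b u ξ)]

lemma integrable_coord_mul_gaussKernel (M : Matrix κ κ ℂ) (b : ℂ)
    (hM : ∀ ξ : κ → ℝ, ξ ≠ 0 → (bil M (cvec ξ) (cvec ξ)).re < 0) (u : κ → ℂ) (j : κ) :
    Integrable fun ξ : κ → ℝ => (ξ j : ℂ) * gaussKernel M b u ξ := by
  obtain ⟨g, hg, hle⟩ := exists_integrable_bound_gaussKernel M b hM ‖u‖
  have hcont := continuous_gaussKernel M b u
  refine hg.mono' (Continuous.aestronglyMeasurable (by fun_prop)) (.of_forall fun ξ => ?_)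
  refine le_trans ?_ (hle u le_rfl ξ)
  rw [norm_mul, Complex.norm_real, Real.norm_eq_abs]
  have : |ξ j| ≤ ∑ i, |ξ i| :=
    Finset.single_le_sum (f := fun i => |ξ i|) (fun i _ => abs_nonneg _) (Finset.mem_univ j)
  exact mul_le_mul_of_nonneg_right (by linarith) (norm_nonneg _)

/-- The derivative of `gaussKernel` in the parameter `u`. -/
def gaussKernelFDeriv (M : Matrix ι ι ℂ) (b : ℂ) (u : ι → ℂ) (ξ : ι → ℝ) : (ι → ℂ) →L[ℂ] ℂ :=
  gaussKernel M b u ξ • b • ∑ i, (ξ i : ℂ) • ContinuousLinearMap.proj (R := ℂ) (φ := fun _ => ℂ) i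

lemma hasFDerivAt_gaussKernel (M : Matrix κ κ ℂ) (b : ℂ) (u : κ → ℂ) (ξ : κ → ℝ) :
    HasFDerivAt (fun v => gaussKernel M b v ξ) (gaussKernelFDeriv M b u ξ) u := by
  have hdot : HasFDerivAt (fun v => dotc (cvec ξ) v)
      (∑ i, (ξ i : ℂ) • ContinuousLinearMap.proj (R := ℂ) (φ := fun _ => ℂ) i) u := by
    unfold dotc cvec
    exact HasFDerivAt.fun_sum fun i _ => (hasFDerivAt_apply i u).const_mul _
  exact ((hdot.const_mul b).const_add _).cexp

lemma norm_gaussKernelFDeriv_le (M : Matrix κ κ ℂ) (b : ℂ) (u : κ → ℂ) (ξ : κ → ℝ) :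
    ‖gaussKernelFDeriv M b u ξ‖ ≤ ‖b‖ * ((1 + ∑ i, |ξ i|) * ‖gaussKernel M b u ξ‖) := by
  have hsum : ‖∑ i, (ξ i : ℂ) • ContinuousLinearMap.proj (R := ℂ) (φ := fun _ : κ => ℂ) i‖
      ≤ ∑ i, |ξ i| := by
    refine (norm_sum_le _ _).trans (Finset.sum_le_sum fun i _ => ?_)
    rw [norm_smul, Complex.norm_real, Real.norm_eq_abs]
    refine mul_le_of_le_one_right (abs_nonneg _) ?_
    exact ContinuousLinearMap.opNorm_le_bound _ zero_le_one fun v => by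
      simpa using norm_le_pi_norm v i
  rw [gaussKernelFDeriv, norm_smul, norm_smul, mul_left_comm, mul_comm (1 + _)]
  gcongr
  linarith

lemma hasFDerivAt_integral_gaussKernel (M : Matrix κ κ ℂ) (b : ℂ)
    (hM : ∀ ξ : κ → ℝ, ξ ≠ 0 → (bil M (cvec ξ) (cvec ξ)).re < 0) (u : κ → ℂ) :
    Integrable (gaussKernelFDeriv M b u) ∧
    HasFDerivAt (fun v => ∫ ξ, gaussKernel M b v ξ) (∫ ξ, gaussKernelFDeriv M b u ξ) u := by
  obtain ⟨g, hg, hle⟩ := exists_integrable_bound_gaussKernel M b hM (‖u‖ + 1)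
  have hmeas : AEStronglyMeasurable (gaussKernelFDeriv M b u) := by
    have hcont := continuous_gaussKernel M b u
    unfold gaussKernelFDeriv
    exact Continuous.aestronglyMeasurable (by fun_prop)
  have hdom : ∀ v ∈ Metric.ball u 1, ∀ ξ, ‖gaussKernelFDeriv M b v ξ‖ ≤ ‖b‖ * g ξ := by
    intro v hv ξ
    refine (norm_gaussKernelFDeriv_le M b v ξ).trans
      (mul_le_mul_of_nonneg_left (hle v ?_ ξ) (norm_nonneg b))
    have h1 := norm_le_norm_add_norm_sub' v u
    rw [mem_ball_iff_norm] at hv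
    linarith
  refine ⟨(hg.const_mul ‖b‖).mono' hmeas
    (.of_forall (hdom u (Metric.mem_ball_self one_pos))), ?_⟩
  exact hasFDerivAt_integral_of_dominated_of_fderiv_le (Metric.ball_mem_nhds u one_pos)
    (.of_forall fun v => (continuous_gaussKernel M b v).aestronglyMeasurable)
    (integrable_gaussKernel M b hM u) hmeas
    (.of_forall fun ξ v hv => hdom v hv ξ) (hg.const_mul ‖b‖)
    (.of_forall fun ξ v _ => hasFDerivAt_gaussKernel M b v ξ)

lemma pd_const_mul_integral_gaussKernel (M : Matrix ι ι ℂ) (b : ℂ)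
    (hM : ∀ ξ : ι → ℝ, ξ ≠ 0 → (bil M (cvec ξ) (cvec ξ)).re < 0) (a : ℂ) (u : ι → ℂ) (j : ι) :
    pd j (fun v => a * ∫ ξ, gaussKernel M b v ξ) u =
      a * (b * ∫ ξ : ι → ℝ, (ξ j : ℂ) * gaussKernel M b u ξ) := by
  obtain ⟨hint, hderiv⟩ := hasFDerivAt_integral_gaussKernel M b hM u
  rw [pd, (hderiv.const_mul a).fderiv, _root_.smul_apply, smul_eq_mul,
    ContinuousLinearMap.integral_apply hint, ← integral_const_mul b]
  refine congrArg (a * ·) (integral_congr_ae (.of_forall fun ξ => ?_))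
  simp [gaussKernelFDeriv, Pi.single_apply]
  ring

lemma hasLineDerivAt_gaussKernel (M : Matrix ι ι ℂ) (hsymm : M.IsSymm) (b : ℂ) (u : ι → ℂ)
    (i : ι) (ξ : ι → ℝ) :
    HasLineDerivAt ℝ (gaussKernel M b u)
      (2 * ∑ j, M i j * ((ξ j : ℂ) * gaussKernel M b u ξ) + b * u i * gaussKernel M b u ξ)
      ξ (Pi.single i 1) := by
  have hcoord : ∀ k, HasDerivAt (fun t : ℝ => cvec (ξ + t • (Pi.single i 1 : ι → ℝ)) k)
      ((Pi.single i 1 : ι → ℂ) k) 0 := by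
    intro k
    have h := (((hasDerivAt_id (0 : ℝ)).mul_const ((Pi.single i 1 : ι → ℝ) k)).const_add
      (ξ k)).ofReal_comp
    refine h.congr_deriv ?_
    by_cases hk : k = i
    · subst hk; simp
    · simp [hk]
  have hbil := HasDerivAt.fun_sum (u := Finset.univ) fun k _ =>
    HasDerivAt.fun_sum (u := Finset.univ) fun l _ =>
      ((hcoord k).mul_const (M k l)).fun_mul (hcoord l)
  have hdot := HasDerivAt.fun_sum (u := Finset.univ) fun k _ => (hcoord k).mul_const (u k)
  have h := (hbil.fun_add (hdot.const_mul b)).cexp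
  unfold HasLineDerivAt
  refine h.congr_deriv ?_
  have hker : Complex.exp (∑ k, ∑ l, cvec ξ k * M k l * cvec ξ l + b * ∑ k, cvec ξ k * u k)
    = gaussKernel M b u ξ := rfl
  simp only [zero_smul, add_zero, hker, Finset.sum_add_distrib]
  have h1 : ∑ k, ∑ l, (Pi.single i 1 : ι → ℂ) k * M k l * cvec ξ l = ∑ j, M i j * ξ j := by
    simp [Pi.single_apply, cvec, ite_mul, Finset.sum_ite_irrel]
  have h2 : ∑ k, ∑ l, cvec ξ k * M k l * (Pi.single i 1 : ι → ℂ) l = ∑ j, M i j * ξ j := by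
    simp [Pi.single_apply, cvec]
    exact Finset.sum_congr rfl fun j _ => by rw [hsymm.apply, mul_comm]
  have h3 : ∑ k, (Pi.single i 1 : ι → ℂ) k * u k = u i := by simp [Pi.single_apply]
  rw [h1, h2, h3]
  simp_rw [← mul_assoc, ← Finset.sum_mul]
  ring

/-- The integral of the total derivative of the Gaussian integrand vanishes. -/
lemma sum_integral_coord_mul_gaussKernel (M : Matrix ι ι ℂ) (hsymm : M.IsSymm) (b : ℂ)
    (hM : ∀ ξ : ι → ℝ, ξ ≠ 0 → (bil M (cvec ξ) (cvec ξ)).re < 0) (u : ι → ℂ) (i : ι) :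
    2 * ∑ j, M i j * (∫ ξ : ι → ℝ, (ξ j : ℂ) * gaussKernel M b u ξ)
      + b * u i * ∫ ξ, gaussKernel M b u ξ = 0 := by
  have hcoord := integrable_coord_mul_gaussKernel M b hM u
  have hker := integrable_gaussKernel M b hM u
  have hsum : Integrable fun ξ : ι → ℝ =>
      2 * ∑ j, M i j * ((ξ j : ℂ) * gaussKernel M b u ξ) :=
    (integrable_finsetSum _ fun j _ => (hcoord j).const_mul _).const_mul _
  have hlin := hker.const_mul (b * u i)
  have hparts := integral_bilinear_hasLineDerivAt_right_eq_neg_left_of_integrable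
    (μ := (volume : Measure (ι → ℝ))) (f := fun _ => (1 : ℂ)) (f' := fun _ => 0)
    (v := Pi.single i 1) (B := ContinuousLinearMap.mul ℝ ℂ)
    (by simp) (by simpa using! hsum.add hlin) (by simpa using hker)
    (fun _ _ => by simp [HasLineDerivAt, hasDerivAt_const])
    (fun ξ _ => hasLineDerivAt_gaussKernel M hsymm b u i ξ)
  simp only [ContinuousLinearMap.mul_apply', one_mul, zero_mul, integral_zero, neg_zero] at hparts
  rw [integral_add hsum hlin, integral_const_mul, integral_const_mul,
    integral_finsetSum _ fun j _ => (hcoord j).const_mul _] at hparts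
  simpa only [integral_const_mul] using hparts

/-- the star-delta function of full variables
`D(u) = (2πℏ)^{-n/2} ∫ exp((1/(4iℏ))ξKξᵀ + (1/(iℏ))⟨ξ,u⟩)dξ` anticommutes with every
generator: `u_i *_K D + D *_K u_i = 0`, the products with the degree-one polynomial `u_i`
being the two-term sums `u_i D + (iℏ/2)Σ_j Λ_{ij}∂_j D` and `D u_i + (iℏ/2)Σ_j Λ_{ji}∂_j D`
with `Λ = K + J`. -/
theorem stmt12 (m : ℕ) (ℏ : ℝ) (hℏ : 0 < ℏ)
    (K J : Matrix (Fin m ⊕ Fin m) (Fin m ⊕ Fin m) ℂ)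
    (hK : K.IsSymm) (hJ : J = Matrix.fromBlocks 0 (-1) 1 0)
    (hpos : ∀ ξ : (Fin m ⊕ Fin m) → ℝ, ξ ≠ 0 →
      0 < ∑ i, ∑ j, ξ i * (Complex.I * K i j).re * ξ j)
    (D : ((Fin m ⊕ Fin m) → ℂ) → ℂ)
    (hD : D = fun u =>
      (((Real.sqrt (2 * Real.pi * ℏ))⁻¹ ^ (2 * m) : ℝ) : ℂ) *
        ∫ ξ : (Fin m ⊕ Fin m) → ℝ,
          Complex.exp ((1 / (4 * Complex.I * ℏ)) * bil K (cvec ξ) (cvec ξ)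
            + (1 / (Complex.I * ℏ)) * dotc (cvec ξ) u)) :
    ∀ (i : Fin m ⊕ Fin m) (u : (Fin m ⊕ Fin m) → ℂ),
      (u i * D u + (Complex.I * ℏ / 2) * ∑ j, (K + J) i j * pd j D u)
        + (D u * u i + (Complex.I * ℏ / 2) * ∑ j, (K + J) j i * pd j D u) = 0 := by
  intro i u
  set M : Matrix (Fin m ⊕ Fin m) (Fin m ⊕ Fin m) ℂ := (1 / (4 * Complex.I * ℏ)) • K with hMdef
  set b : ℂ := 1 / (Complex.I * ℏ) with hb
  set a : ℂ := (((Real.sqrt (2 * Real.pi * ℏ))⁻¹ ^ (2 * m) : ℝ) : ℂ)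
  have hℏ' : (ℏ : ℂ) ≠ 0 := by exact_mod_cast hℏ.ne'
  have hbil : ∀ ξ : (Fin m ⊕ Fin m) → ℂ,
      bil M ξ ξ = (1 / (4 * Complex.I * ℏ)) * bil K ξ ξ := by
    intro ξ
    simp only [bil, hMdef, Matrix.smul_apply, smul_eq_mul, Finset.mul_sum]
    exact Finset.sum_congr rfl fun k _ => Finset.sum_congr rfl fun l _ => by ring
  have hsymm : M.IsSymm := hK.smul _
  have hM : ∀ ξ : (Fin m ⊕ Fin m) → ℝ, ξ ≠ 0 → (bil M (cvec ξ) (cvec ξ)).re < 0 := by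
    intro ξ hξ
    have hre : (bil M (cvec ξ) (cvec ξ)).re =
        -(1 / (4 * ℏ)) * ∑ i, ∑ j, ξ i * (Complex.I * K i j).re * ξ j := by
      have hI : bil M (cvec ξ) (cvec ξ) = ((-(1 / (4 * ℏ)) : ℝ) : ℂ) *
          ∑ i, ∑ j, (ξ i : ℂ) * (Complex.I * K i j) * ξ j := by
        rw [hbil]
        simp only [bil, cvec, Finset.mul_sum]
        refine Finset.sum_congr rfl fun k _ => Finset.sum_congr rfl fun l _ => ?_
        push_cast
        field_simp
        rw [Complex.I_sq]
        ring
      rw [hI, Complex.re_ofReal_mul]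
      simp only [Complex.re_sum, Complex.re_mul_ofReal, Complex.re_ofReal_mul]
    rw [hre]
    exact mul_neg_of_neg_of_pos (by simpa using hℏ) (hpos ξ hξ)
  have hD' : D = fun v => a * ∫ ξ, gaussKernel M b v ξ := by
    simp only [hD, gaussKernel, hbil]
  have hskew : ∀ j, (K + J) i j + (K + J) j i = 2 * K i j := by
    intro j
    have hJskew : J i j + J j i = 0 := by
      rw [hJ]
      rcases i with i | i <;> rcases j with j | j <;>
        simp [Matrix.fromBlocks, Matrix.one_apply, eq_comm]
    rw [Matrix.add_apply, Matrix.add_apply, hK.apply i j]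
    linear_combination hJskew
  have hcomb : (u i * D u + (Complex.I * ℏ / 2) * ∑ j, (K + J) i j * pd j D u)
      + (D u * u i + (Complex.I * ℏ / 2) * ∑ j, (K + J) j i * pd j D u)
      = 2 * (u i * D u) + (Complex.I * ℏ) * ∑ j, K i j * pd j D u := by
    have : ∑ j, (K + J) i j * pd j D u + ∑ j, (K + J) j i * pd j D u
        = 2 * ∑ j, K i j * pd j D u := by
      rw [← Finset.sum_add_distrib, Finset.mul_sum]
      exact Finset.sum_congr rfl fun j _ => by rw [← add_mul, hskew, mul_assoc]
    linear_combination (Complex.I * ℏ / 2) * this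
  have hzero := sum_integral_coord_mul_gaussKernel M hsymm b hM u i
  have hpd : ∑ j, K i j * pd j D u = 4 * a *
      ∑ j, M i j * (∫ ξ, (ξ j : ℂ) * gaussKernel M b u ξ) := by
    rw [Finset.mul_sum]
    refine Finset.sum_congr rfl fun j _ => ?_
    rw [hD', pd_const_mul_integral_gaussKernel M b hM, hMdef, Matrix.smul_apply, smul_eq_mul, hb]
    field_simp
  rw [hcomb, hpd]
  simp only [hD']
  have hb' : Complex.I * ℏ * b = 1 := by
    rw [hb]
    field_simp
  linear_combination (2 * a * (Complex.I * ℏ)) * hzero -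
    (2 * a * u i * ∫ ξ, gaussKernel M b u ξ) * hb'

end
end

section
/- Let n = 2m, let J be the standard skew-symmetric matrix, and let K ∈ Mat_n(ℂ) be symmetric with iK of positive-definite real part. Fix a ∈ ℝⁿ and u ∈ ℂⁿ. Then for each ξ ∈ ℝⁿ the inner integral H(ξ) = (2πħ)^(−n/2) ∫_{ℝⁿ} exp( (1/(4iħ)) (ξ+η) K (ξ+η)ᵀ + (1/(2iħ)) ξJηᵀ + (1/(iħ)) ⟨ξ+η, u−a⟩ ) dη converges absolutely, the function H is absolutely integrable on ℝⁿ, and (2πħ)^(−n/2) ∫_{ℝⁿ} H(ξ) dξ = 2ⁿ. (This is the paper's identity δ*(u−a) * δ*(u−a) = 2^{2m} for the star-delta function of full variables, written as an iterated Gaussian integral in the K-ordered expression.) -/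
open MeasureTheory

noncomputable section

variable {ι : Type} [Fintype ι] [DecidableEq ι]

open Matrix in
/-- Simultaneous diagonalization by congruence of two real quadratic forms, one of them positive
definite. -/
theorem exists_congruence_one_diagonal {A B : Matrix ι ι ℝ} (hA : A.PosDef) (hB : B.IsHermitian) :
    ∃ (P : Matrix ι ι ℝ) (d : ι → ℝ), P.det ≠ 0 ∧ Pᵀ * A * P = 1 ∧ Pᵀ * B * P = diagonal d := by
  open scoped MatrixOrder Matrix.Norms.L2Operator in
  obtain ⟨C, hC, rfl⟩ :=
    CStarAlgebra.isStrictlyPositive_iff_eq_star_mul_self.mp hA.isStrictlyPositive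
  have hCdet : IsUnit C.det := (isUnit_iff_isUnit_det C).mp hC
  have hS : ((C⁻¹)ᴴ * B * C⁻¹).IsHermitian := isHermitian_conjTranspose_mul_mul _ hB
  let U : Matrix ι ι ℝ := hS.eigenvectorUnitary
  have hUU : Uᵀ * U = 1 := by
    rw [← conjTranspose_eq_transpose_of_trivial, ← star_eq_conjTranspose]
    exact Unitary.coe_star_mul_self hS.eigenvectorUnitary
  have hdiag : Uᵀ * ((C⁻¹)ᴴ * B * C⁻¹) * U = diagonal hS.eigenvalues := by
    have h := hS.spectral_theorem
    rw [Unitary.conjStarAlgAut_apply] at h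
    change (C⁻¹)ᴴ * B * C⁻¹ = U * diagonal hS.eigenvalues * star U at h
    rw [star_eq_conjTranspose, conjTranspose_eq_transpose_of_trivial U] at h
    calc Uᵀ * ((C⁻¹)ᴴ * B * C⁻¹) * U = Uᵀ * (U * diagonal hS.eigenvalues * Uᵀ) * U :=
          congrArg (fun S => Uᵀ * S * U) h
      _ = (Uᵀ * U) * diagonal hS.eigenvalues * (Uᵀ * U) := by simp only [Matrix.mul_assoc]
      _ = _ := by rw [hUU, Matrix.one_mul, Matrix.mul_one]
  refine ⟨C⁻¹ * U, hS.eigenvalues, ?_, ?_, ?_⟩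
  · rw [det_mul]
    refine mul_ne_zero ((isUnit_nonsing_inv_det C hCdet).ne_zero) fun h => ?_
    have := congrArg det hUU
    simp [h] at this
  · rw [star_eq_conjTranspose, conjTranspose_eq_transpose_of_trivial, transpose_mul]
    calc Uᵀ * (C⁻¹)ᵀ * (Cᵀ * C) * (C⁻¹ * U)
        = Uᵀ * ((C * C⁻¹)ᵀ * (C * C⁻¹)) * U := by simp only [Matrix.mul_assoc, transpose_mul]
      _ = 1 := by simp [mul_nonsing_inv C hCdet, hUU]
  · rw [← hdiag, conjTranspose_eq_transpose_of_trivial, transpose_mul]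
    simp only [Matrix.mul_assoc]

open Matrix in
theorem measurableEmbedding_mulVec {P : Matrix ι ι ℝ} (hP : P.det ≠ 0) :
    MeasurableEmbedding fun x : ι → ℝ => P *ᵥ x := by
  have hinj : Function.Injective fun x : ι → ℝ => P *ᵥ x :=
    mulVec_injective_iff_isUnit.mpr ((isUnit_iff_isUnit_det P).mpr hP.isUnit)
  exact (LinearMap.isClosedEmbedding_of_injective (f := toLin' P)
    (LinearMap.ker_eq_bot.mpr hinj)).measurableEmbedding

open Matrix in
theorem map_mulVec_volume {P : Matrix ι ι ℝ} (hP : P.det ≠ 0) :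
    (volume : Measure (ι → ℝ)).map (fun x => P *ᵥ x) = ENNReal.ofReal |P.det⁻¹| • volume :=
  Real.map_matrix_volume_pi_eq_smul_volume_pi hP

open Matrix in
theorem integrable_comp_mulVec_iff {P : Matrix ι ι ℝ} (hP : P.det ≠ 0) {f : (ι → ℝ) → ℂ} :
    Integrable (fun x => f (P *ᵥ x)) ↔ Integrable f := by
  rw [← Function.comp_def f, ← (measurableEmbedding_mulVec hP).integrable_map_iff,
    map_mulVec_volume hP, integrable_smul_measure (by simp [hP]) ENNReal.ofReal_ne_top]

open Matrix in
theorem integral_comp_mulVec {P : Matrix ι ι ℝ} (hP : P.det ≠ 0) (f : (ι → ℝ) → ℂ) :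
    ∫ x, f (P *ᵥ x) = ((|P.det|⁻¹ : ℝ) : ℂ) * ∫ x, f x := by
  rw [← (measurableEmbedding_mulVec hP).integral_map f, map_mulVec_volume hP,
    integral_smul_measure, ENNReal.toReal_ofReal (abs_nonneg _), abs_inv, Complex.real_smul]

open Complex in
/-- The Fourier transform of a diagonal complex Gaussian is integrable, and its integral is given
by Fourier inversion. -/
theorem integral_integral_cexp_diagonal {κ : Type} [Fintype κ] {b : κ → ℂ}
    (hb : ∀ i, 0 < (b i).re) (e : κ → ℂ) :
    Integrable (fun y : κ → ℝ => ∫ x : κ → ℝ,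
      cexp (-∑ i, b i * (x i : ℂ) ^ 2 + ∑ i, (e i + I * y i) * x i)) ∧
    ∫ y : κ → ℝ, ∫ x : κ → ℝ,
      cexp (-∑ i, b i * (x i : ℂ) ^ 2 + ∑ i, (e i + I * y i) * x i) =
        (2 * Real.pi) ^ Fintype.card κ := by
  have hb0 : ∀ i, b i ≠ 0 := fun i h => by simpa [h] using hb i
  have hb' : ∀ i, 0 < (1 / (4 * b i)).re := fun i => by
    rw [one_div, inv_re]
    refine div_pos (by simpa using hb i) (normSq_pos.mpr (by simpa using hb0 i))
  have key : ∀ y : κ → ℝ, ∫ x : κ → ℝ,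
      cexp (-∑ i, b i * (x i : ℂ) ^ 2 + ∑ i, (e i + I * y i) * x i) =
      (∏ i, (Real.pi / b i) ^ (1 / 2 : ℂ) * cexp (e i ^ 2 / (4 * b i))) *
        cexp (-∑ i, 1 / (4 * b i) * (y i : ℂ) ^ 2 + ∑ i, (e i * I / (2 * b i)) * y i) := by
    intro y
    rw [GaussianFourier.integral_cexp_neg_sum_mul_add hb, ← Finset.sum_neg_distrib,
      ← Finset.sum_add_distrib, Complex.exp_sum, ← Finset.prod_mul_distrib]
    refine Finset.prod_congr rfl fun i _ => ?_
    rw [mul_assoc, ← Complex.exp_add]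
    congr 2
    have := hb0 i
    field_simp
    ring_nf
    rw [I_sq]
    ring
  simp_rw [key]
  refine ⟨(GaussianFourier.integrable_cexp_neg_sum_mul_add hb' _).const_mul _, ?_⟩
  rw [integral_const_mul, GaussianFourier.integral_cexp_neg_sum_mul_add hb',
    ← Finset.prod_mul_distrib, ← Finset.card_univ, ← Finset.prod_const]
  refine Finset.prod_congr rfl fun i _ => ?_
  have hbi := hb0 i
  have hexp : cexp (e i ^ 2 / (4 * b i)) *
      cexp ((e i * I / (2 * b i)) ^ 2 / (4 * (1 / (4 * b i)))) = 1 := by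
    rw [← Complex.exp_add, Complex.exp_eq_one_iff]
    refine ⟨0, ?_⟩
    field_simp
    rw [I_sq]
    ring
  have hroot : (Real.pi / b i) ^ (1 / 2 : ℂ) * (Real.pi / (1 / (4 * b i))) ^ (1 / 2 : ℂ) =
      2 * Real.pi := by
    have hpi : (Real.pi : ℂ) ≠ 0 := by exact_mod_cast Real.pi_ne_zero
    have hre : 0 < ((Real.pi : ℂ) / b i).re := by
      rw [div_eq_mul_inv, re_ofReal_mul, inv_re]
      exact mul_pos Real.pi_pos (div_pos (hb i) (normSq_pos.mpr hbi))
    have harg : arg ((Real.pi : ℂ) / b i) ≠ Real.pi := fun h => by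
      linarith [(arg_eq_pi_iff.mp h).1]
    have hne : (Real.pi : ℂ) / b i ≠ 0 := div_ne_zero hpi hbi
    have h1 : (Real.pi : ℂ) / (1 / (4 * b i)) =
        (((2 * Real.pi) ^ 2 : ℝ) : ℂ) * (Real.pi / b i)⁻¹ := by
      push_cast
      field_simp
      ring
    have hpi2 : 0 < 2 * Real.pi := by positivity
    have hlog : log (((2 * Real.pi) ^ 2 : ℝ) * (Real.pi / b i)⁻¹) =
        2 * (Real.log (2 * Real.pi) : ℂ) - log (Real.pi / b i) := by
      rw [log_ofReal_mul (by positivity) (inv_ne_zero hne), log_inv _ harg, Real.log_pow]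
      push_cast
      ring
    rw [h1, cpow_def_of_ne_zero hne, cpow_def_of_ne_zero
      (mul_ne_zero (ofReal_ne_zero.mpr (by positivity)) (inv_ne_zero hne)), hlog, ← Complex.exp_add]
    calc _ = cexp (Real.log (2 * Real.pi)) := by
          congr 1
          ring
      _ = 2 * Real.pi := by
          rw [← ofReal_exp, Real.exp_log hpi2]
          push_cast
          rfl
  calc _ = ((Real.pi / b i) ^ (1 / 2 : ℂ) * (Real.pi / (1 / (4 * b i))) ^ (1 / 2 : ℂ)) *
      (cexp (e i ^ 2 / (4 * b i)) *
        cexp ((e i * I / (2 * b i)) ^ 2 / (4 * (1 / (4 * b i))))) := by ring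
    _ = _ := by rw [hexp, hroot, mul_one]

open Matrix in
theorem bil_eq_dotProduct {κ : Type} [Fintype κ] (M : Matrix κ κ ℂ) (a b : κ → ℂ) :
    bil M a b = a ⬝ᵥ M *ᵥ b := by
  simp [bil, dotProduct, mulVec, Finset.mul_sum, mul_assoc]

open Matrix in
theorem cvec_mulVec {κ : Type} [Fintype κ] (M : Matrix κ κ ℝ) (x : κ → ℝ) :
    cvec (M *ᵥ x) = M.map Complex.ofReal *ᵥ cvec x := by
  ext i
  simp [cvec, mulVec, dotProduct]

open Matrix in
theorem dotc_cvec_cvec {κ : Type} [Fintype κ] (x y : κ → ℝ) :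
    dotc (cvec x) (cvec y) = ((x ⬝ᵥ y : ℝ) : ℂ) := by
  simp [dotc, cvec, dotProduct]

open Matrix Complex in
/-- The Fourier transform of a complex Gaussian, precomposed with an invertible linear map, is
integrable, and its integral is given by Fourier inversion. -/
theorem integral_integral_cexp_bil {M : Matrix ι ι ℂ} (hM : M.IsSymm)
    (hMre : (M.map re).PosDef) {R : Matrix ι ι ℝ} (hR : R.det ≠ 0) (e : ι → ℂ) :
    (∀ ξ : ι → ℝ, Integrable fun x : ι → ℝ =>
      cexp (-bil M (cvec x) (cvec x) + dotc (cvec x) (e + I • cvec (R *ᵥ ξ)))) ∧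
    Integrable (fun ξ : ι → ℝ => ∫ x : ι → ℝ,
      cexp (-bil M (cvec x) (cvec x) + dotc (cvec x) (e + I • cvec (R *ᵥ ξ)))) ∧
    ∫ ξ : ι → ℝ, ∫ x : ι → ℝ,
      cexp (-bil M (cvec x) (cvec x) + dotc (cvec x) (e + I • cvec (R *ᵥ ξ))) =
        ((|R.det|⁻¹ : ℝ) : ℂ) * (2 * Real.pi) ^ Fintype.card ι := by
  have hMim : (M.map im).IsHermitian := by
    ext i j
    simp [hM.apply j i]
  obtain ⟨P, d, hP, hPre, hPim⟩ := exists_congruence_one_diagonal hMre hMim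
  have hsplit : M = (M.map re).map ofReal + I • (M.map im).map ofReal := by
    ext i j
    simp [mul_comm I, re_add_im]
  have hbil : ∀ x : ι → ℝ, bil M (cvec (P *ᵥ x)) (cvec (P *ᵥ x)) =
      ∑ i, (1 + I * d i) * (x i : ℂ) ^ 2 := by
    intro x
    have hPMP : (P.map ofReal)ᵀ * M * P.map ofReal = diagonal fun i => 1 + I * (d i : ℂ) := by
      have hre : (P.map ofReal)ᵀ * (M.map re).map ofReal * P.map ofReal = 1 := by
        have h := congrArg (fun Q => Q.map ofRealHom) hPre
        simp only [Matrix.map_mul,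
          Matrix.map_one _ (map_zero ofRealHom) (map_one ofRealHom)] at h
        exact h
      have him : (P.map ofReal)ᵀ * (M.map im).map ofReal * P.map ofReal =
          diagonal fun i => (d i : ℂ) := by
        have h := congrArg (fun Q => Q.map ofRealHom) hPim
        simp only [Matrix.map_mul, diagonal_map (map_zero ofRealHom)] at h
        exact h
      rw [hsplit, Matrix.mul_add, Matrix.add_mul, Matrix.mul_smul, Matrix.smul_mul, hre, him,
        ← diagonal_one, ← diagonal_smul, diagonal_add]
      rfl
    rw [bil_eq_dotProduct, cvec_mulVec, mulVec_mulVec, ← vecMul_transpose, ← dotProduct_mulVec,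
      mulVec_mulVec, ← Matrix.mul_assoc, hPMP]
    simp only [dotProduct, mulVec_diagonal, cvec]
    exact Finset.sum_congr rfl fun i _ => by ring
  have hdot : ∀ x ξ : ι → ℝ, dotc (cvec (P *ᵥ x)) (e + I • cvec (R *ᵥ ξ)) =
      ∑ i, (((P.map ofReal)ᵀ *ᵥ e) i + I * ((Pᵀ * R) *ᵥ ξ) i) * x i := by
    intro x ξ
    have h2 : (fun i => ((P.map ofReal)ᵀ *ᵥ e) i + I * (((Pᵀ * R) *ᵥ ξ) i : ℂ)) =
        (P.map ofReal)ᵀ *ᵥ (e + I • cvec (R *ᵥ ξ)) := by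
      rw [mulVec_add, mulVec_smul, ← transpose_map, ← cvec_mulVec, mulVec_mulVec]
      rfl
    calc _ = (P.map ofReal *ᵥ cvec x) ⬝ᵥ (e + I • cvec (R *ᵥ ξ)) := by rw [← cvec_mulVec]; rfl
      _ = cvec x ⬝ᵥ (P.map ofReal)ᵀ *ᵥ (e + I • cvec (R *ᵥ ξ)) := by
        rw [← vecMul_transpose, ← dotProduct_mulVec]
      _ = _ := by
        rw [← h2]
        exact Finset.sum_congr rfl fun i _ => mul_comm _ _
  have hb : ∀ i, 0 < (1 + I * (d i : ℂ)).re := fun i => by simp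
  have hPR : (Pᵀ * R).det ≠ 0 := by
    rw [det_mul, det_transpose]
    exact mul_ne_zero hP hR
  have hinner : ∀ ξ : ι → ℝ, ∫ x : ι → ℝ,
      cexp (-bil M (cvec x) (cvec x) + dotc (cvec x) (e + I • cvec (R *ᵥ ξ))) =
      (|P.det| : ℝ) * ∫ x : ι → ℝ, cexp (-∑ i, (1 + I * d i) * (x i : ℂ) ^ 2 +
        ∑ i, (((P.map ofReal)ᵀ *ᵥ e) i + I * ((Pᵀ * R) *ᵥ ξ) i) * x i) := by
    intro ξ
    simp_rw [← hbil, ← hdot]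
    rw [integral_comp_mulVec hP
      fun x => cexp (-bil M (cvec x) (cvec x) + dotc (cvec x) (e + I • cvec (R *ᵥ ξ))),
      ← mul_assoc, ← ofReal_mul, mul_inv_cancel₀ (abs_ne_zero.mpr hP), ofReal_one, one_mul]
  obtain ⟨hint, hval⟩ := integral_integral_cexp_diagonal hb ((P.map ofReal)ᵀ *ᵥ e)
  refine ⟨fun ξ => ?_, ?_, ?_⟩
  · rw [← integrable_comp_mulVec_iff hP]
    simp_rw [hbil, hdot]
    exact GaussianFourier.integrable_cexp_neg_sum_mul_add hb _
  · simp_rw [hinner]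
    exact ((integrable_comp_mulVec_iff hPR).mpr hint).const_mul _
  · simp_rw [hinner]
    rw [integral_const_mul, integral_comp_mulVec hPR fun y : ι → ℝ => ∫ x : ι → ℝ,
        cexp (-∑ i, (1 + I * d i) * (x i : ℂ) ^ 2 +
          ∑ i, (((P.map ofReal)ᵀ *ᵥ e) i + I * y i) * x i),
      hval, ← mul_assoc, ← ofReal_mul, det_mul, det_transpose, abs_mul, mul_inv,
      mul_inv_cancel_left₀ (abs_ne_zero.mpr hP)]

/-- the identity `δ*(u−a) * δ*(u−a) = 2^{2m}` for the star-delta function of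
full variables, as an iterated Gaussian integral in the K-ordered expression: the inner
integral `H(ξ)` converges absolutely, `H` is absolutely integrable, and
`(2πℏ)^{-n/2} ∫ H(ξ)dξ = 2ⁿ` (with `n = 2m`). -/
theorem stmt13 (m : ℕ) (ℏ : ℝ) (hℏ : 0 < ℏ)
    (K J : Matrix (Fin m ⊕ Fin m) (Fin m ⊕ Fin m) ℂ)
    (hK : K.IsSymm) (hJ : J = Matrix.fromBlocks 0 (-1) 1 0)
    (hpos : ∀ ξ : (Fin m ⊕ Fin m) → ℝ, ξ ≠ 0 →
      0 < ∑ i, ∑ j, ξ i * (Complex.I * K i j).re * ξ j)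
    (a : (Fin m ⊕ Fin m) → ℝ) (u : (Fin m ⊕ Fin m) → ℂ)
    (H : ((Fin m ⊕ Fin m) → ℝ) → ℂ)
    (hH : H = fun ξ =>
      (((Real.sqrt (2 * Real.pi * ℏ))⁻¹ ^ (2 * m) : ℝ) : ℂ) *
        ∫ η : (Fin m ⊕ Fin m) → ℝ,
          Complex.exp ((1 / (4 * Complex.I * ℏ)) *
              bil K (cvec ξ + cvec η) (cvec ξ + cvec η)
            + (1 / (2 * Complex.I * ℏ)) * bil J (cvec ξ) (cvec η)
            + (1 / (Complex.I * ℏ)) * dotc (cvec ξ + cvec η) (u - cvec a))) :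
    (∀ ξ : (Fin m ⊕ Fin m) → ℝ,
      Integrable (fun η : (Fin m ⊕ Fin m) → ℝ =>
        Complex.exp ((1 / (4 * Complex.I * ℏ)) *
            bil K (cvec ξ + cvec η) (cvec ξ + cvec η)
          + (1 / (2 * Complex.I * ℏ)) * bil J (cvec ξ) (cvec η)
          + (1 / (Complex.I * ℏ)) * dotc (cvec ξ + cvec η) (u - cvec a))) volume) ∧
    Integrable H volume ∧
    (((Real.sqrt (2 * Real.pi * ℏ))⁻¹ ^ (2 * m) : ℝ) : ℂ) *
        (∫ ξ : (Fin m ⊕ Fin m) → ℝ, H ξ) = 2 ^ (2 * m) := by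
  have hℏ0 : (ℏ : ℂ) ≠ 0 := by exact_mod_cast hℏ.ne'
  let R : Matrix (Fin m ⊕ Fin m) (Fin m ⊕ Fin m) ℝ :=
    (-(2 * ℏ)⁻¹) • (Matrix.J (Fin m) ℝ).transpose
  have hJdet : |(Matrix.J (Fin m) ℝ).det| = 1 := by
    rw [← sq_eq_sq₀ (abs_nonneg _) zero_le_one, sq_abs, sq, Matrix.J_det_mul_J_det, one_pow]
  have hRdet : |R.det| = ((2 * ℏ)⁻¹) ^ (2 * m) := by
    rw [Matrix.det_smul, Matrix.det_transpose, abs_mul, hJdet, mul_one, abs_pow, abs_neg,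
      abs_of_pos (by positivity)]
    simp [two_mul]
  have hR : R.det ≠ 0 := by
    rw [← abs_pos, hRdet]
    positivity
  have hM : ((Complex.I / (4 * ℏ)) • K).IsSymm := hK.smul _
  have hMre : (((Complex.I / (4 * ℏ)) • K).map Complex.re).PosDef := by
    have hre : ∀ i j, (((Complex.I / (4 * ℏ)) • K).map Complex.re) i j =
        (4 * ℏ)⁻¹ * (Complex.I * K i j).re := by
      intro i j
      rw [← Complex.re_ofReal_mul]
      simp only [Matrix.map_apply, Matrix.smul_apply, smul_eq_mul]
      congr 1
      push_cast
      ring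
    refine Matrix.PosDef.of_dotProduct_mulVec_pos ?_ fun x hx => ?_
    · ext i j
      rw [Matrix.conjTranspose_apply, hre, hre, hK.apply, star_trivial]
    · have h := mul_pos (inv_pos.mpr (by positivity : 0 < 4 * ℏ)) (hpos x hx)
      convert h using 1
      simp only [dotProduct, Matrix.mulVec, hre, Finset.mul_sum, star_trivial]
      exact Finset.sum_congr rfl fun i _ => Finset.sum_congr rfl fun j _ => by ring
  obtain ⟨h₁, h₂, h₃⟩ := integral_integral_cexp_bil hM hMre hR
    ((1 / (Complex.I * ℏ)) • (u - cvec a))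
  have hshift : ∀ ξ η : (Fin m ⊕ Fin m) → ℝ,
      Complex.exp ((1 / (4 * Complex.I * ℏ)) * bil K (cvec ξ + cvec η) (cvec ξ + cvec η)
            + (1 / (2 * Complex.I * ℏ)) * bil J (cvec ξ) (cvec η)
            + (1 / (Complex.I * ℏ)) * dotc (cvec ξ + cvec η) (u - cvec a)) =
      Complex.exp (-bil ((Complex.I / (4 * ℏ)) • K) (cvec (ξ + η)) (cvec (ξ + η)) +
        dotc (cvec (ξ + η)) ((1 / (Complex.I * ℏ)) • (u - cvec a) +
          Complex.I • cvec (R.mulVec ξ))) := by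
    intro ξ η
    have hadd : cvec ξ + cvec η = cvec (ξ + η) := by
      ext i
      simp [cvec]
    have hKbil : -bil ((Complex.I / (4 * ℏ)) • K) (cvec (ξ + η)) (cvec (ξ + η)) =
        (1 / (4 * Complex.I * ℏ)) * bil K (cvec (ξ + η)) (cvec (ξ + η)) := by
      simp only [bil, Finset.mul_sum, ← Finset.sum_neg_distrib, Matrix.smul_apply, smul_eq_mul]
      refine Finset.sum_congr rfl fun i _ => Finset.sum_congr rfl fun j _ => ?_
      field_simp
      rw [Complex.I_sq]
      ring
    have hRdot : dotc (cvec (ξ + η)) (Complex.I • cvec (R.mulVec ξ)) =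
        (1 / (2 * Complex.I * ℏ)) * bil J (cvec ξ) (cvec η) := by
      have hJbil : bil J (cvec ξ) (cvec η) =
          ((ξ ⬝ᵥ (Matrix.J (Fin m) ℝ).mulVec η : ℝ) : ℂ) := by
        have hJmap : J = (Matrix.J (Fin m) ℝ).map Complex.ofReal := by
          rw [hJ]
          exact (Matrix.map_J (Fin m) Complex.ofRealHom).symm
        rw [bil_eq_dotProduct, hJmap, ← cvec_mulVec]
        exact dotc_cvec_cvec _ _
      have hskew : ξ ⬝ᵥ (Matrix.J (Fin m) ℝ).mulVec ξ = 0 := by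
        have h := Matrix.dotProduct_mulVec ξ (Matrix.J (Fin m) ℝ) ξ
        rw [← Matrix.mulVec_transpose, Matrix.J_transpose, Matrix.neg_mulVec, neg_dotProduct,
          dotProduct_comm _ ξ] at h
        linarith
      have hreal : (ξ + η) ⬝ᵥ R.mulVec ξ =
          -(2 * ℏ)⁻¹ * (ξ ⬝ᵥ (Matrix.J (Fin m) ℝ).mulVec η) := by
        rw [Matrix.smul_mulVec, dotProduct_smul, Matrix.mulVec_transpose, dotProduct_comm,
          ← Matrix.dotProduct_mulVec, Matrix.mulVec_add, dotProduct_add, hskew, zero_add,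
          smul_eq_mul]
      calc dotc (cvec (ξ + η)) (Complex.I • cvec (R.mulVec ξ))
          = Complex.I * dotc (cvec (ξ + η)) (cvec (R.mulVec ξ)) := dotProduct_smul _ _ _
        _ = _ := by
          rw [dotc_cvec_cvec, hreal, hJbil]
          push_cast
          field_simp
          rw [Complex.I_sq]
          ring
    have hdot_add : dotc (cvec (ξ + η)) ((1 / (Complex.I * ℏ)) • (u - cvec a) +
        Complex.I • cvec (R.mulVec ξ)) =
        (1 / (Complex.I * ℏ)) * dotc (cvec (ξ + η)) (u - cvec a) +
          dotc (cvec (ξ + η)) (Complex.I • cvec (R.mulVec ξ)) := by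
      change cvec (ξ + η) ⬝ᵥ _ = _
      rw [dotProduct_add, dotProduct_smul]
      rfl
    rw [hadd, hKbil, hdot_add, hRdot]
    ring_nf
  simp_rw [hshift] at hH ⊢
  have htrans : ∀ ξ : (Fin m ⊕ Fin m) → ℝ, _ := fun ξ => integral_add_left_eq_self
    (μ := volume) (fun x : (Fin m ⊕ Fin m) → ℝ =>
      Complex.exp (-bil ((Complex.I / (4 * ℏ)) • K) (cvec x) (cvec x) +
        dotc (cvec x) ((1 / (Complex.I * ℏ)) • (u - cvec a) +
          Complex.I • cvec (R.mulVec ξ)))) ξ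
  simp_rw [htrans] at hH
  subst hH
  refine ⟨fun ξ => (h₁ ξ).comp_add_left ξ, h₂.const_mul _, ?_⟩
  have hcard : Fintype.card (Fin m ⊕ Fin m) = 2 * m := by simp [two_mul]
  rw [integral_const_mul, h₃, hRdet, hcard]
  have hsqrt : Real.sqrt (2 * Real.pi * ℏ) * Real.sqrt (2 * Real.pi * ℏ) = 2 * Real.pi * ℏ :=
    Real.mul_self_sqrt (by positivity)
  rw [← inv_pow, inv_inv]
  norm_cast
  rw [← mul_pow, ← mul_pow, ← mul_pow, Nat.cast_pow, Nat.cast_ofNat]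
  congr 1
  have : (Real.sqrt (2 * Real.pi * ℏ))⁻¹ * (Real.sqrt (2 * Real.pi * ℏ))⁻¹ =
    (2 * Real.pi * ℏ)⁻¹ := by rw [← mul_inv, hsqrt]
  rw [← mul_assoc, this]
  have := Real.pi_ne_zero
  field_simp

end
end

section
/- Let m ≥ 1, n = 2m, and let K ∈ Mat_n(ℂ) be symmetric with iK of positive-definite real part; write K in m×m blocks as K = [[K₁₁, K₁₂],[K₂₁, K₂₂]] and write ξ = (ξ̃, η̃) ∈ ℝᵐ × ℝᵐ. Fix ũ, ṽ ∈ ℂᵐ and ỹ ∈ ℝᵐ. For x̃ ∈ ℝᵐ let G(x̃) = (2πħ)^(−m) ∫_{ℝ^{2m}} exp( (1/(4iħ)) ξKξᵀ + (1/(iħ)) ( ⟨ξ̃, ũ − x̃⟩ + ⟨η̃, ṽ − ỹ⟩ ) ) dξ̃ dη̃. Then G is absolutely integrable on ℝᵐ and (2πħ)^(−m/2) ∫_{ℝᵐ} G(x̃) dx̃ = (2πħ)^(−m/2) ∫_{ℝᵐ} exp( (1/(4iħ)) η̃K₂₂η̃ᵀ + (1/(iħ)) ⟨η̃, ṽ −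 ỹ⟩ ) dη̃. (Integrating the K-ordered full-variable star-delta δ*(u − x), u = (ũ,ṽ), x = (x̃,ỹ), over the configuration variables x̃ yields the K-ordered half-variable star-delta δ*(ṽ − ỹ).) -/
open MeasureTheory

noncomputable section

variable {ι : Type} [Fintype ι] [DecidableEq ι]

/-- A real symmetric matrix is diagonalized by an orthogonal congruence. -/
lemma exists_orthogonal_diagonalization {A : Matrix ι ι ℝ} (hA : A.IsHermitian) :
    ∃ U : Matrix ι ι ℝ, U.transpose * U = 1 ∧
      U.transpose * A * U = Matrix.diagonal hA.eigenvalues := by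
  have hU : (star hA.eigenvectorUnitary : Matrix ι ι ℝ) * hA.eigenvectorUnitary = 1 :=
    Unitary.coe_star_mul_self _
  have ht : (star hA.eigenvectorUnitary : Matrix ι ι ℝ)
      = (hA.eigenvectorUnitary : Matrix ι ι ℝ).transpose := by
    rw [Matrix.star_eq_conjTranspose, Matrix.conjTranspose_eq_transpose_of_trivial]
  refine ⟨hA.eigenvectorUnitary, by rw [← ht, hU], ?_⟩
  have h := hA.conjStarAlgAut_star_eigenvectorUnitary
  rw [Unitary.conjStarAlgAut_apply] at h
  simpa [← ht] using h

/-- A positive definite and a symmetric real matrix are simultaneously diagonalizable by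
congruence. -/
lemma exists_simultaneous_congruence {A B : Matrix ι ι ℝ} (hA : A.PosDef) (hB : B.IsHermitian) :
    ∃ (P : Matrix ι ι ℝ) (d : ι → ℝ), P.det ≠ 0 ∧ P.transpose * A * P = 1 ∧
      P.transpose * B * P = Matrix.diagonal d := by
  obtain ⟨U, -, hU'⟩ := exists_orthogonal_diagonalization hA.isHermitian
  set R : Matrix ι ι ℝ := Matrix.diagonal fun i => (Real.sqrt (hA.isHermitian.eigenvalues i))⁻¹
    with hR
  have hQ : (U * R).transpose * A * (U * R) = 1 := by
    have : (U * R).transpose * A * (U * R) = R * (U.transpose * A * U) * R := by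
      simp [hR, Matrix.transpose_mul, Matrix.mul_assoc]
    rw [this, hU', hR, Matrix.diagonal_mul_diagonal, Matrix.diagonal_mul_diagonal,
      ← Matrix.diagonal_one]
    congr 1
    funext i
    have hi := hA.eigenvalues_pos i
    have hs := Real.sqrt_pos.2 hi
    field_simp
    exact (Real.sq_sqrt hi.le).symm
  have hB' : ((U * R).transpose * B * (U * R)).IsHermitian := by
    simpa [Matrix.conjTranspose_eq_transpose_of_trivial] using
      Matrix.isHermitian_conjTranspose_mul_mul (U * R) hB
  obtain ⟨V, hV, hV'⟩ := exists_orthogonal_diagonalization hB'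
  have h1 : (U * R * V).transpose * A * (U * R * V) = 1 := by
    calc _ = V.transpose * ((U * R).transpose * A * (U * R)) * V := by
          simp [Matrix.transpose_mul, Matrix.mul_assoc]
      _ = 1 := by rw [hQ, Matrix.mul_one, hV]
  refine ⟨U * R * V, hB'.eigenvalues, fun h0 => ?_, h1, ?_⟩
  · simpa [Matrix.det_mul, h0] using congrArg Matrix.det h1
  · rw [← hV']
    simp [Matrix.transpose_mul, Matrix.mul_assoc]

lemma dotProduct_mulVec_congruence {α : Type*} [Fintype α] (A P : Matrix α α ℝ) (z : α → ℝ) :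
    ∑ i, ∑ j, P.mulVec z i * A i j * P.mulVec z j
      = dotProduct z ((P.transpose * A * P).mulVec z) := by
  rw [← Matrix.mulVec_mulVec, ← Matrix.mulVec_mulVec, Matrix.dotProduct_mulVec,
    Matrix.vecMul_transpose]
  simp only [dotProduct, Matrix.mulVec, Finset.mul_sum, mul_assoc]

/-- A symmetric complex matrix with positive definite real part becomes diagonal, with entries of
positive real part, after a real linear change of variables. -/
lemma exists_bil_diagonal {M : Matrix ι ι ℂ} (hM : M.IsSymm)
    (hpos : ∀ ξ : ι → ℝ, ξ ≠ 0 → 0 < ∑ i, ∑ j, ξ i * (M i j).re * ξ j) :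
    ∃ (P : Matrix ι ι ℝ) (b : ι → ℂ), P.det ≠ 0 ∧ (∀ j, 0 < (b j).re) ∧
      ∀ z : ι → ℝ, bil M (cvec (P.mulVec z)) (cvec (P.mulVec z)) = ∑ j, b j * (z j : ℂ) ^ 2 := by
  have hA : (M.map Complex.re).PosDef := by
    refine Matrix.PosDef.of_dotProduct_mulVec_pos ?_ fun x hx => ?_
    · ext i j
      simp [hM.apply i j]
    · simpa [dotProduct, Matrix.mulVec, Finset.mul_sum, mul_assoc] using hpos x hx
  have hB : (M.map Complex.im).IsHermitian := by
    ext i j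
    simp [hM.apply i j]
  obtain ⟨P, d, hP, h1, h2⟩ := exists_simultaneous_congruence hA hB
  refine ⟨P, fun j => 1 + d j * Complex.I, hP, fun j => by simp, fun z => ?_⟩
  have hre := dotProduct_mulVec_congruence (M.map Complex.re) P z
  have him := dotProduct_mulVec_congruence (M.map Complex.im) P z
  rw [h1] at hre
  rw [h2] at him
  have hsplit : bil M (cvec (P.mulVec z)) (cvec (P.mulVec z))
      = ((∑ i, ∑ j, P.mulVec z i * (M.map Complex.re) i j * P.mulVec z j : ℝ) : ℂ)
        + ((∑ i, ∑ j, P.mulVec z i * (M.map Complex.im) i j * P.mulVec z j : ℝ) : ℂ)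
          * Complex.I := by
    simp only [bil, cvec, Complex.ofReal_sum, Finset.sum_mul, ← Finset.sum_add_distrib]
    refine Finset.sum_congr rfl fun i _ => Finset.sum_congr rfl fun j _ => ?_
    conv_lhs => rw [← Complex.re_add_im (M i j)]
    push_cast [Matrix.map_apply]
    ring
  rw [hsplit, hre, him]
  simp only [Matrix.one_mulVec, dotProduct, Matrix.mulVec_diagonal, Complex.ofReal_sum,
    Finset.sum_mul, ← Finset.sum_add_distrib]
  refine Finset.sum_congr rfl fun i _ => ?_
  push_cast
  ring

/-- A negative diagonal quadratic form plus a linear form, pulled back along an injective linear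
map, is bounded above by a constant minus a multiple of the standard quadratic form. -/
lemma exists_quadratic_upper_bound {α κ : Type*} [Fintype α] [Fintype κ]
    (T : (κ → ℝ) →ₗ[ℝ] (α → ℝ))
    (hT : Function.Injective T) {a : α → ℝ} (ha : ∀ j, 0 < a j) (c : α → ℝ) :
    ∃ C ε : ℝ, 0 < ε ∧ ∀ x : κ → ℝ,
      ∑ j, (-(a j) * (T x j) ^ 2 + c j * T x j) ≤ C - ε * ∑ k, (x k) ^ 2 := by
  obtain ⟨L, hL, hLT⟩ := LinearMap.exists_antilipschitzWith T (LinearMap.ker_eq_bot.2 hT)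
  obtain ⟨a₀, ha₀, ha₀'⟩ : ∃ a₀ > 0, ∀ j, a₀ ≤ a j := by
    rcases isEmpty_or_nonempty α with h | h
    · exact ⟨1, one_pos, fun j => isEmptyElim j⟩
    · obtain ⟨j, hj⟩ := Finite.exists_min a
      exact ⟨a j, ha j, hj⟩
  have hN : 0 < (L : ℝ) ^ 2 * (Fintype.card κ + 1) := by positivity
  refine ⟨∑ j, c j ^ 2 / (2 * a j), a₀ / 2 / ((L : ℝ) ^ 2 * (Fintype.card κ + 1)),
    by positivity, fun x => ?_⟩
  have h1 : ∀ j, -(a j) * (T x j) ^ 2 + c j * T x j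
      ≤ c j ^ 2 / (2 * a j) - a₀ / 2 * (T x j) ^ 2 := fun j => by
    have h : c j * T x j ≤ c j ^ 2 / (2 * a j) + a j / 2 * (T x j) ^ 2 := by
      have := ha j
      rw [← sub_nonneg]
      have e : c j ^ 2 / (2 * a j) + a j / 2 * (T x j) ^ 2 - c j * T x j
          = (c j - a j * T x j) ^ 2 / (2 * a j) := by
        field_simp
        ring
      rw [e]
      positivity
    nlinarith [ha₀' j, sq_nonneg (T x j)]
  have h2 : ‖T x‖ ^ 2 ≤ ∑ j, (T x j) ^ 2 := by
    rw [← Real.le_sqrt (norm_nonneg _) (by positivity)]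
    refine (pi_norm_le_iff_of_nonneg (Real.sqrt_nonneg _)).2 fun j => ?_
    rw [Real.norm_eq_abs, ← Real.sqrt_sq_eq_abs]
    exact Real.sqrt_le_sqrt
      (Finset.single_le_sum (f := fun j => (T x j) ^ 2) (fun i _ => sq_nonneg _)
        (Finset.mem_univ j))
  have h3 : ∑ k, (x k) ^ 2 ≤ (L : ℝ) ^ 2 * (Fintype.card κ + 1) * ∑ j, (T x j) ^ 2 := by
    have hx : ‖x‖ ≤ L * ‖T x‖ := by simpa using hLT.le_mul_dist x 0
    have hx2 : ‖x‖ ^ 2 ≤ (L : ℝ) ^ 2 * ‖T x‖ ^ 2 := by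
      rw [← mul_pow]
      exact pow_le_pow_left₀ (norm_nonneg _) hx 2
    have hsum : ∑ k, (x k) ^ 2 ≤ Fintype.card κ * ‖x‖ ^ 2 := by
      refine (Finset.sum_le_card_nsmul _ _ (‖x‖ ^ 2) fun k _ => ?_).trans_eq (by simp)
      rw [← sq_abs, ← Real.norm_eq_abs]
      exact pow_le_pow_left₀ (norm_nonneg _) (norm_le_pi_norm x k) 2
    have h4 : ‖x‖ ^ 2 ≤ (L : ℝ) ^ 2 * ∑ j, (T x j) ^ 2 := by
      refine hx2.trans ?_
      gcongr
    have h5 : (0 : ℝ) ≤ (Fintype.card κ : ℝ) := by positivity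
    nlinarith [sq_nonneg ‖x‖]
  calc ∑ j, (-(a j) * (T x j) ^ 2 + c j * T x j)
      ≤ ∑ j, (c j ^ 2 / (2 * a j) - a₀ / 2 * (T x j) ^ 2) := Finset.sum_le_sum fun j _ => h1 j
    _ = (∑ j, c j ^ 2 / (2 * a j)) - a₀ / 2 * ∑ j, (T x j) ^ 2 := by
        rw [Finset.sum_sub_distrib, Finset.mul_sum]
    _ ≤ _ := by
        refine sub_le_sub_left ?_ _
        rw [div_mul_eq_mul_div, div_le_iff₀ hN]
        nlinarith

lemma integrable_exp_sub_mul_sum_sq {κ : Type*} [Fintype κ] (C : ℝ) {ε : ℝ} (hε : 0 < ε) :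
    Integrable fun x : κ → ℝ => Real.exp (C - ε * ∑ k, (x k) ^ 2) := by
  have h := (GaussianFourier.integrable_cexp_neg_mul_sum_add (ι := κ) (b := (ε : ℂ))
    (by simpa using hε) 0).norm.const_mul (Real.exp C)
  refine h.congr (Filter.Eventually.of_forall fun x => ?_)
  simp only [Complex.norm_exp, ← Real.exp_add]
  congr 1
  simp only [Pi.zero_apply, zero_mul, Finset.sum_const_zero, add_zero]
  have : (-(ε : ℂ) * ∑ i, (x i : ℂ) ^ 2) = ((-ε * ∑ i, (x i) ^ 2 : ℝ) : ℂ) := by push_cast; rfl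
  rw [this, Complex.ofReal_re]
  ring

lemma integral_eq_abs_det_mul_integral_mulVec {P : Matrix ι ι ℝ} (hP : P.det ≠ 0)
    {f : (ι → ℝ) → ℂ} (hf : Continuous f) :
    ∫ ξ, f ξ = (|P.det| : ℝ) * ∫ z, f (P.mulVec z) := by
  have hmap := Real.map_matrix_volume_pi_eq_smul_volume_pi hP
  have hcont : Continuous (Matrix.toLin' P) := LinearMap.continuous_of_finiteDimensional _
  have h := integral_map (μ := volume) hcont.aemeasurable (f := f) hf.aestronglyMeasurable
  rw [hmap, integral_smul_measure, ENNReal.toReal_ofReal (abs_nonneg _), abs_inv] at h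
  simp only [Matrix.toLin'_apply] at h
  rw [← h, Complex.real_smul, ← mul_assoc, ← Complex.ofReal_mul,
    mul_inv_cancel₀ (abs_ne_zero.2 hP), Complex.ofReal_one, one_mul]

lemma continuous_cexp_neg_bil_add {α : Type} [Fintype α] (M : Matrix α α ℂ) (c : α → ℂ) :
    Continuous fun ξ : α → ℝ =>
      Complex.exp (-bil M (cvec ξ) (cvec ξ) + ∑ i, c i * (ξ i : ℂ)) := by
  unfold bil cvec
  fun_prop

lemma sum_mul_mulVec_ofReal {α : Type} [Fintype α] (P : Matrix α α ℝ) (c : α → ℂ) (z : α → ℝ) :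
    ∑ i, c i * ((P.mulVec z i : ℝ) : ℂ) = ∑ j, (∑ i, c i * (P i j : ℂ)) * (z j : ℂ) := by
  simp only [Matrix.mulVec, dotProduct, Complex.ofReal_sum, Complex.ofReal_mul, Finset.mul_sum,
    Finset.sum_mul]
  rw [Finset.sum_comm]
  simp only [mul_assoc]

/-- A Gaussian with complex symmetric quadratic form of positive definite real part is dominated
by an isotropic real Gaussian. -/
lemma exists_norm_cexp_neg_bil_add_le {M : Matrix ι ι ℂ} (hM : M.IsSymm)
    (hpos : ∀ ξ : ι → ℝ, ξ ≠ 0 → 0 < ∑ i, ∑ j, ξ i * (M i j).re * ξ j) (c : ι → ℂ) :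
    ∃ C ε : ℝ, 0 < ε ∧ ∀ ξ : ι → ℝ,
      ‖Complex.exp (-bil M (cvec ξ) (cvec ξ) + ∑ i, c i * (ξ i : ℂ))‖
        ≤ Real.exp (C - ε * ∑ i, (ξ i) ^ 2) := by
  obtain ⟨P, b, hP, hb, hdiag⟩ := exists_bil_diagonal hM hpos
  have hPu : IsUnit P.det := isUnit_iff_ne_zero.2 hP
  have hinj : Function.Injective (Matrix.toLin' P⁻¹) := by
    intro x y hxy
    simpa [Matrix.mulVec_mulVec, Matrix.mul_nonsing_inv P hPu] using congrArg P.mulVec hxy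
  obtain ⟨C, ε, hε, h⟩ := exists_quadratic_upper_bound (Matrix.toLin' P⁻¹) hinj hb
    fun j => (∑ i, c i * (P i j : ℂ)).re
  refine ⟨C, ε, hε, fun ξ => ?_⟩
  rw [Complex.norm_exp, Real.exp_le_exp]
  refine le_trans (le_of_eq ?_) (h ξ)
  have hξ : P.mulVec (P⁻¹.mulVec ξ) = ξ := by
    rw [Matrix.mulVec_mulVec, Matrix.mul_nonsing_inv P hPu, Matrix.one_mulVec]
  conv_lhs => rw [← hξ, hdiag, sum_mul_mulVec_ofReal]
  rw [Matrix.toLin'_apply, ← Finset.sum_neg_distrib, ← Finset.sum_add_distrib, Complex.re_sum]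
  refine Finset.sum_congr rfl fun j _ => ?_
  rw [← Complex.ofReal_pow, Complex.add_re, Complex.neg_re, Complex.re_mul_ofReal,
    Complex.re_mul_ofReal, neg_mul]

lemma integrable_cexp_neg_bil_add {M : Matrix ι ι ℂ} (hM : M.IsSymm)
    (hpos : ∀ ξ : ι → ℝ, ξ ≠ 0 → 0 < ∑ i, ∑ j, ξ i * (M i j).re * ξ j) (c : ι → ℂ) :
    Integrable fun ξ : ι → ℝ =>
      Complex.exp (-bil M (cvec ξ) (cvec ξ) + ∑ i, c i * (ξ i : ℂ)) := by
  obtain ⟨C, ε, hε, h⟩ := exists_norm_cexp_neg_bil_add_le hM hpos c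
  exact (integrable_exp_sub_mul_sum_sq C hε).mono'
    (continuous_cexp_neg_bil_add M c).aestronglyMeasurable (Filter.Eventually.of_forall h)

/-- The Fourier transform of a complex Gaussian is integrable along every affine subspace. -/
lemma integrable_integral_cexp_neg_bil_add {κ : Type*} [Fintype κ] {M : Matrix ι ι ℂ}
    (hM : M.IsSymm)
    (hpos : ∀ ξ : ι → ℝ, ξ ≠ 0 → 0 < ∑ i, ∑ j, ξ i * (M i j).re * ξ j) (c : ι → ℂ)
    (S : (κ → ℝ) →ₗ[ℝ] (ι → ℝ)) (hS : Function.Injective S) :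
    Integrable fun x : κ → ℝ => ∫ ξ : ι → ℝ,
      Complex.exp (-bil M (cvec ξ) (cvec ξ)
        + ∑ i, (c i + (S x i : ℂ) * Complex.I) * (ξ i : ℂ)) := by
  obtain ⟨P, b, hP, hb, hdiag⟩ := exists_bil_diagonal hM hpos
  set γ : ι → ℂ := fun j => ∑ i, c i * (P i j : ℂ) with hγ
  set T : (κ → ℝ) →ₗ[ℝ] (ι → ℝ) := (Matrix.toLin' P.transpose).comp S with hT
  have hTinj : Function.Injective T := by
    rw [hT, LinearMap.coe_comp]
    refine Function.Injective.comp ?_ hS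
    have hPu : IsUnit P.transpose.det := by
      rw [Matrix.det_transpose]
      exact isUnit_iff_ne_zero.2 hP
    intro x y hxy
    simpa [Matrix.mulVec_mulVec, Matrix.nonsing_inv_mul _ hPu] using
      congrArg P.transpose⁻¹.mulVec hxy
  have hTx : ∀ x j, ∑ i, (c i + (S x i : ℂ) * Complex.I) * (P i j : ℂ)
      = γ j + (T x j : ℂ) * Complex.I := fun x j => by
    simp only [hT, hγ, LinearMap.comp_apply, Matrix.toLin'_apply, Matrix.mulVec, dotProduct,
      Matrix.transpose_apply, Complex.ofReal_sum, Complex.ofReal_mul, Finset.sum_mul,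
      ← Finset.sum_add_distrib]
    exact Finset.sum_congr rfl fun i _ => by ring
  have hformula : ∀ x : κ → ℝ, (∫ ξ : ι → ℝ, Complex.exp (-bil M (cvec ξ) (cvec ξ)
        + ∑ i, (c i + (S x i : ℂ) * Complex.I) * (ξ i : ℂ)))
      = (|P.det| : ℝ) * ∏ j, ((Real.pi : ℂ) / b j) ^ (1 / 2 : ℂ)
          * Complex.exp ((γ j + (T x j : ℂ) * Complex.I) ^ 2 / (4 * b j)) := fun x => by
    rw [integral_eq_abs_det_mul_integral_mulVec hP (continuous_cexp_neg_bil_add M _)]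
    simp only [hdiag, sum_mul_mulVec_ofReal, hTx]
    rw [GaussianFourier.integral_cexp_neg_sum_mul_add hb]
  simp only [hformula]
  have hTc : Continuous T := LinearMap.continuous_of_finiteDimensional _
  obtain ⟨C, ε, hε, h⟩ := exists_quadratic_upper_bound T hTinj
    (a := fun j => ((4 * b j)⁻¹).re)
    (fun j => by
      have h4 : 0 < (4 * b j).re := by simpa using hb j
      rw [Complex.inv_re]
      exact div_pos h4 (Complex.normSq_pos.2 fun h0 => by simp [h0] at h4))
    (fun j => (2 * γ j * Complex.I * (4 * b j)⁻¹).re)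
  refine Integrable.const_mul ?_ _
  simp only [Finset.prod_mul_distrib]
  refine Integrable.const_mul ?_ _
  simp only [← Complex.exp_sum]
  refine (integrable_exp_sub_mul_sum_sq (C + ∑ j, (γ j ^ 2 * (4 * b j)⁻¹).re) hε).mono'
    (Continuous.aestronglyMeasurable (by fun_prop)) (Filter.Eventually.of_forall fun x => ?_)
  rw [Complex.norm_exp, Real.exp_le_exp]
  have hre : (∑ j, (γ j + (T x j : ℂ) * Complex.I) ^ 2 / (4 * b j)).re
      = ∑ j, (-((4 * b j)⁻¹).re * (T x j) ^ 2
            + (2 * γ j * Complex.I * (4 * b j)⁻¹).re * T x j)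
        + ∑ j, (γ j ^ 2 * (4 * b j)⁻¹).re := by
    rw [Complex.re_sum, ← Finset.sum_add_distrib]
    refine Finset.sum_congr rfl fun j _ => ?_
    have e : (γ j + (T x j : ℂ) * Complex.I) ^ 2 / (4 * b j)
        = -((4 * b j)⁻¹ * ((T x j ^ 2 : ℝ) : ℂ))
          + 2 * γ j * Complex.I * (4 * b j)⁻¹ * (T x j : ℂ) + γ j ^ 2 * (4 * b j)⁻¹ := by
      rw [div_eq_mul_inv]
      push_cast
      linear_combination (T x j : ℂ) ^ 2 * (4 * b j)⁻¹ * Complex.I_sq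
    rw [e, Complex.add_re, Complex.add_re, Complex.neg_re, Complex.re_mul_ofReal,
      Complex.re_mul_ofReal, neg_mul]
  rw [hre]
  linarith [h x]

/-- **Fourier inversion at the origin** with a scaled phase. -/
lemma integral_integral_cexp_mul {κ : Type*} [Fintype κ] {F : (κ → ℝ) → ℂ} (hF : Integrable F)
    (hFc : Continuous F) {r : ℝ} (hr : 0 < r)
    (hH : Integrable fun x : κ → ℝ => ∫ ξ : κ → ℝ,
      Complex.exp (r * Complex.I * ∑ i, (ξ i : ℂ) * (x i : ℂ)) * F ξ) :
    ∫ x : κ → ℝ, ∫ ξ : κ → ℝ, Complex.exp (r * Complex.I * ∑ i, (ξ i : ℂ) * (x i : ℂ)) * F ξ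
      = ((2 * Real.pi / r) ^ Fintype.card κ : ℝ) * F 0 := by
  set H : (κ → ℝ) → ℂ := fun x => ∫ ξ : κ → ℝ,
    Complex.exp (r * Complex.I * ∑ i, (ξ i : ℂ) * (x i : ℂ)) * F ξ with hHdef
  set R : ℝ := -(2 * Real.pi / r) with hR
  have hR0 : R ≠ 0 := by
    rw [hR]
    have := Real.pi_pos
    exact neg_ne_zero.2 (by positivity)
  set E : EuclideanSpace ℝ κ → ℂ := fun v => F (WithLp.ofLp v) with hE
  have hofLp := PiLp.volume_preserving_ofLp κ
  have hemb : MeasurableEmbedding (WithLp.ofLp : EuclideanSpace ℝ κ → κ → ℝ) :=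
    (MeasurableEquiv.toLp 2 (κ → ℝ)).symm.measurableEmbedding
  have hEi : Integrable E := (hofLp.integrable_comp_emb hemb).2 hF
  have hEc : Continuous E := hFc.comp (PiLp.continuous_ofLp 2 _)
  have hFour : ∀ w : EuclideanSpace ℝ κ,
      FourierTransform.fourier E w = H (R • WithLp.ofLp w) := fun w => by
    rw [Real.fourier_eq', hHdef]
    beta_reduce
    rw [← hofLp.integral_comp hemb]
    refine integral_congr_ae (Filter.Eventually.of_forall fun v => ?_)
    simp only [smul_eq_mul, hE]
    congr 2
    simp only [PiLp.inner_apply, RCLike.inner_apply, conj_trivial, Pi.smul_apply, smul_eq_mul, hR]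
    push_cast
    simp only [Finset.mul_sum, Finset.sum_mul]
    refine Finset.sum_congr rfl fun i _ => ?_
    have : (r : ℂ) ≠ 0 := by exact_mod_cast hr.ne'
    field_simp
  have hHi : Integrable fun y : κ → ℝ => H (R • y) := hH.comp_smul hR0
  have hFi : Integrable (FourierTransform.fourier E) := by
    rw [funext hFour]
    exact (hofLp.integrable_comp_emb hemb).2 hHi
  have hinv := congrFun (hEc.fourierInv_fourier_eq hEi hFi) 0
  rw [Real.fourierInv_eq'] at hinv
  simp only [inner_zero_right, mul_zero, Complex.ofReal_zero, zero_mul, Complex.exp_zero,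
    one_smul, hFour] at hinv
  rw [hofLp.integral_comp hemb (fun y => H (R • y)), Measure.integral_comp_smul] at hinv
  have h0 : E 0 = F 0 := rfl
  rw [h0] at hinv
  rw [← hinv, Module.finrank_fintype_fun_eq_card, Complex.real_smul, ← mul_assoc,
    ← Complex.ofReal_mul, abs_inv, abs_pow, hR, abs_neg,
    abs_of_pos (div_pos (mul_pos two_pos Real.pi_pos) hr), mul_inv_cancel₀, Complex.ofReal_one,
    one_mul]
  have := Real.pi_pos
  positivity

lemma integrable_comp_sumElim {α β : Type*} [Fintype α] [Fintype β] {f : (α ⊕ β → ℝ) → ℂ}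
    (hf : Integrable f) :
    Integrable (fun p : (α → ℝ) × (β → ℝ) => f (Sum.elim p.1 p.2)) (volume.prod volume) := by
  have h := (volume_measurePreserving_sumPiEquivProdPi_symm (fun _ : α ⊕ β => ℝ))
  refine ((h.integrable_comp_emb (MeasurableEquiv.measurableEmbedding _)).2 hf).congr
    (Filter.Eventually.of_forall fun p => congrArg f ?_)
  ext (i | i) <;> rfl

lemma integral_eq_integral_integral_sumElim {α β : Type*} [Fintype α] [Fintype β]
    {f : (α ⊕ β → ℝ) → ℂ} (hf : Integrable f) :
    ∫ ξ, f ξ = ∫ x : α → ℝ, ∫ y : β → ℝ, f (Sum.elim x y) := by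
  have h := (volume_measurePreserving_sumPiEquivProdPi_symm (fun _ : α ⊕ β => ℝ))
  rw [← integral_prod _ (integrable_comp_sumElim hf),
    ← h.integral_comp (MeasurableEquiv.measurableEmbedding _)]
  refine integral_congr_ae (Filter.Eventually.of_forall fun p => congrArg f ?_)
  ext (i | i) <;> rfl

/-- The partial integral of a continuous function with Gaussian decay is continuous. -/
lemma continuous_integral_sumElim {α β : Type*} [Fintype α] [Fintype β] {f : (α ⊕ β → ℝ) → ℂ}
    (hf : Continuous f) {C ε : ℝ} (hε : 0 < ε)
    (h : ∀ ξ, ‖f ξ‖ ≤ Real.exp (C - ε * ∑ i, (ξ i) ^ 2)) :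
    Continuous fun x : α → ℝ => ∫ y : β → ℝ, f (Sum.elim x y) := by
  have hcont : Continuous fun p : (α → ℝ) × (β → ℝ) => f (Sum.elim p.1 p.2) := by
    refine hf.comp (continuous_pi fun i => ?_)
    rcases i with i | i
    · exact (continuous_apply i).comp continuous_fst
    · exact (continuous_apply i).comp continuous_snd
  refine continuous_of_dominated
    (bound := fun y : β → ℝ => Real.exp (C - ε * ∑ i, (y i) ^ 2)) (fun x => ?_) (fun x => ?_)
    (integrable_exp_sub_mul_sum_sq C hε) ?_
  · exact (hcont.comp (Continuous.prodMk_right x)).aestronglyMeasurable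
  · refine Filter.Eventually.of_forall fun y => (h _).trans (Real.exp_le_exp.2 ?_)
    simp only [Fintype.sum_sum_type, Sum.elim_inl, Sum.elim_inr]
    have : 0 ≤ ∑ i, (x i) ^ 2 := by positivity
    nlinarith
  · exact Filter.Eventually.of_forall fun y => hcont.comp (Continuous.prodMk_left y)

/-- integrating the K-ordered full-variable star-delta
`δ*(u−x)`, `u = (ũ,ṽ)`, `x = (x̃,ỹ)`, over the configuration variables `x̃` yields the
K-ordered half-variable star-delta `δ*(ṽ−ỹ)` (whose expression involves only the block
`K₂₂`).  The `2m` variables are indexed by `Fin m ⊕ Fin m`, with `ξ = (ξ̃, η̃)` split via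
`Sum.elim`. -/
theorem stmt18 (m : ℕ) (hm : 1 ≤ m) (ℏ : ℝ) (hℏ : 0 < ℏ)
    (K : Matrix (Fin m ⊕ Fin m) (Fin m ⊕ Fin m) ℂ)
    (hK : K.IsSymm)
    (hpos : ∀ ξ : (Fin m ⊕ Fin m) → ℝ, ξ ≠ 0 →
      0 < ∑ i, ∑ j, ξ i * (Complex.I * K i j).re * ξ j)
    (ut vt : Fin m → ℂ) (yt : Fin m → ℝ)
    (G : (Fin m → ℝ) → ℂ)
    (hG : G = fun xt =>
      (((Real.sqrt (2 * Real.pi * ℏ))⁻¹ ^ (2 * m) : ℝ) : ℂ) *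
        ∫ ξ : (Fin m ⊕ Fin m) → ℝ,
          Complex.exp ((1 / (4 * Complex.I * ℏ)) * bil K (cvec ξ) (cvec ξ)
            + (1 / (Complex.I * ℏ)) *
              (dotc (cvec (ξ ∘ Sum.inl)) (ut - cvec xt)
                + dotc (cvec (ξ ∘ Sum.inr)) (vt - cvec yt)))) :
    Integrable G volume ∧
    (((Real.sqrt (2 * Real.pi * ℏ))⁻¹ ^ m : ℝ) : ℂ) * (∫ xt : Fin m → ℝ, G xt)
      = (((Real.sqrt (2 * Real.pi * ℏ))⁻¹ ^ m : ℝ) : ℂ) *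
          ∫ ηt : Fin m → ℝ,
            Complex.exp ((1 / (4 * Complex.I * ℏ)) *
                bil (fun i j : Fin m => K (Sum.inr i) (Sum.inr j)) (cvec ηt) (cvec ηt)
              + (1 / (Complex.I * ℏ)) * dotc (cvec ηt) (vt - cvec yt)) := by
  have hℏc : (ℏ : ℂ) ≠ 0 := by exact_mod_cast hℏ.ne'
  set M : Matrix (Fin m ⊕ Fin m) (Fin m ⊕ Fin m) ℂ := (Complex.I / (4 * ℏ)) • K with hM
  have hMs : M.IsSymm := hK.smul _
  have hMpos : ∀ ξ : (Fin m ⊕ Fin m) → ℝ, ξ ≠ 0 →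
      0 < ∑ i, ∑ j, ξ i * (M i j).re * ξ j := fun ξ hξ => by
    have h : ∑ i, ∑ j, ξ i * (M i j).re * ξ j
        = (4 * ℏ)⁻¹ * ∑ i, ∑ j, ξ i * (Complex.I * K i j).re * ξ j := by
      simp only [Finset.mul_sum]
      refine Finset.sum_congr rfl fun i _ => Finset.sum_congr rfl fun j _ => ?_
      have e : M i j = Complex.I * K i j * (((4 * ℏ)⁻¹ : ℝ) : ℂ) := by
        rw [hM, Matrix.smul_apply, smul_eq_mul]
        push_cast
        ring
      rw [e, Complex.re_mul_ofReal]
      ring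
    rw [h]
    exact mul_pos (by positivity) (hpos ξ hξ)
  have hscal : 1 / (4 * Complex.I * ℏ) = -(Complex.I / (4 * ℏ)) := by
    field_simp
    simp
  have hscal' : 1 / (Complex.I * ℏ) = -(Complex.I / ℏ) := by
    field_simp
    simp
  set c : Fin m ⊕ Fin m → ℂ :=
    Sum.elim (fun i => 1 / (Complex.I * ℏ) * ut i)
      (fun i => 1 / (Complex.I * ℏ) * (vt i - (yt i : ℂ))) with hc
  set S : (Fin m → ℝ) →ₗ[ℝ] (Fin m ⊕ Fin m → ℝ) :=
    { toFun := fun x => Sum.elim (ℏ⁻¹ • x) 0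
      map_add' := fun x y => by
        ext (i | i) <;> simp
      map_smul' := fun a x => by
        ext (i | i) <;> simp [mul_left_comm] } with hS
  have hSinj : Function.Injective S := fun x y hxy => by
    funext i
    simpa [hS, hℏ.ne'] using congrFun hxy (Sum.inl i)
  set f : (Fin m ⊕ Fin m → ℝ) → ℂ := fun ξ =>
    Complex.exp (-bil M (cvec ξ) (cvec ξ) + ∑ i, c i * (ξ i : ℂ)) with hf
  set N : ℂ := (((Real.sqrt (2 * Real.pi * ℏ))⁻¹ ^ (2 * m) : ℝ) : ℂ) with hN
  have hbil : ∀ ξ : Fin m ⊕ Fin m → ℝ,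
      (1 / (4 * Complex.I * ℏ)) * bil K (cvec ξ) (cvec ξ) = -bil M (cvec ξ) (cvec ξ) :=
    fun ξ => by
      rw [hscal, neg_mul]
      simp only [bil, hM, Matrix.smul_apply, smul_eq_mul, Finset.mul_sum]
      congr 1
      exact Finset.sum_congr rfl fun i _ => Finset.sum_congr rfl fun j _ => by ring
  have hG1 : G = fun x => N * ∫ ξ : Fin m ⊕ Fin m → ℝ,
      Complex.exp (-bil M (cvec ξ) (cvec ξ)
        + ∑ i, (c i + (S x i : ℂ) * Complex.I) * (ξ i : ℂ)) := by
    rw [hG]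
    funext x
    congr 1
    refine integral_congr_ae (Filter.Eventually.of_forall fun ξ => ?_)
    simp only [hbil]
    congr 2
    simp only [dotc, cvec, hc, hS, Fintype.sum_sum_type, mul_add, Finset.mul_sum,
      Function.comp_apply, Pi.sub_apply, LinearMap.coe_mk, AddHom.coe_mk, Sum.elim_inl,
      Sum.elim_inr, Pi.smul_apply, smul_eq_mul, Pi.zero_apply]
    congr 1 <;> refine Finset.sum_congr rfl fun i _ => ?_
    · rw [hscal']
      push_cast
      field_simp
      ring
    · push_cast
      ring
  have hGint : Integrable G := by
    rw [hG1]
    exact (integrable_integral_cexp_neg_bil_add hMs hMpos c S hSinj).const_mul N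
  refine ⟨hGint, ?_⟩
  congr 1
  set F : (Fin m → ℝ) → ℂ := fun x => ∫ η : Fin m → ℝ, f (Sum.elim x η) with hF
  have hfi : Integrable f := integrable_cexp_neg_bil_add hMs hMpos c
  have hfc : Continuous f := continuous_cexp_neg_bil_add M c
  have hFi : Integrable F := (integrable_comp_sumElim hfi).integral_prod_left
  have hFc : Continuous F := by
    obtain ⟨C, ε, hε, h⟩ := exists_norm_cexp_neg_bil_add_le hMs hMpos c
    exact continuous_integral_sumElim hfc hε h
  have hG2 : G = fun x => N * ∫ ξ : Fin m → ℝ,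
      Complex.exp ((ℏ⁻¹ : ℝ) * Complex.I * ∑ i, (ξ i : ℂ) * (x i : ℂ)) * F ξ := by
    rw [hG1]
    funext x
    congr 1
    rw [integral_eq_integral_integral_sumElim]
    · refine integral_congr_ae (Filter.Eventually.of_forall fun ξ => ?_)
      simp only [hF]
      rw [← integral_const_mul]
      refine integral_congr_ae (Filter.Eventually.of_forall fun η => ?_)
      simp only [hf, ← Complex.exp_add]
      congr 1
      simp only [hS, Fintype.sum_sum_type, LinearMap.coe_mk, AddHom.coe_mk, Sum.elim_inl,
        Sum.elim_inr, Pi.smul_apply, smul_eq_mul, Pi.zero_apply, add_mul,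
        Finset.sum_add_distrib, Finset.mul_sum, Complex.ofReal_zero, zero_mul,
        Finset.sum_const_zero]
      have e : ∀ i, ((ℏ⁻¹ : ℝ) : ℂ) * Complex.I * ((ξ i : ℂ) * (x i : ℂ))
          = ((ℏ⁻¹ * x i : ℝ) : ℂ) * Complex.I * (ξ i : ℂ) := fun i => by
        push_cast
        ring
      simp only [e]
      ring
    · exact integrable_cexp_neg_bil_add hMs hMpos _
  have hN0 : N ≠ 0 := by
    rw [hN]
    have := Real.pi_pos
    exact_mod_cast (by positivity : (Real.sqrt (2 * Real.pi * ℏ))⁻¹ ^ (2 * m) ≠ 0)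
  have hH : Integrable fun x : Fin m → ℝ => ∫ ξ : Fin m → ℝ,
      Complex.exp ((ℏ⁻¹ : ℝ) * Complex.I * ∑ i, (ξ i : ℂ) * (x i : ℂ)) * F ξ := by
    rw [hG2] at hGint
    exact (integrable_const_mul_iff (isUnit_iff_ne_zero.2 hN0) _).1 hGint
  rw [hG2, integral_const_mul, integral_integral_cexp_mul hFi hFc (inv_pos.2 hℏ) hH, ← mul_assoc,
    hN, ← Complex.ofReal_mul]
  have hone : (Real.sqrt (2 * Real.pi * ℏ))⁻¹ ^ (2 * m)
      * (2 * Real.pi / ℏ⁻¹) ^ Fintype.card (Fin m) = 1 := by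
    have := Real.pi_pos
    rw [pow_mul, inv_pow, Real.sq_sqrt (by positivity), div_inv_eq_mul, Fintype.card_fin,
      ← mul_pow, inv_mul_cancel₀ (by positivity), one_pow]
  rw [hone, Complex.ofReal_one, one_mul]
  refine integral_congr_ae (Filter.Eventually.of_forall fun η => ?_)
  simp only [hf, ← hbil]
  simp [bil, dotc, cvec, hc, Fintype.sum_sum_type, Finset.mul_sum, mul_comm, mul_left_comm, mul_assoc]

end
end
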